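/- Closure of infinite Gray codes under basic operations, part 1 (Lemma 6.2(1)): if p : ℕ → ℤ is an infinite Gray code of x, then: (a) the tail of p, fun i => p (i+1), is an infinite Gray code of t(x) = 1 - 2|x|; (b) the sequence obtained from p by negating its head (fun i => if i = 0 then -(p 0) else p i) is an infinite Gray code of -x; and (c) the sequence whose head is 1 and whose tail is fun i => p (i+1) is an infinite Gray code of |x|. -/

import Mathlib

noncomputable def tent (x : ℝ) : ℝ := 1 - 2 * |x|

def IsGrayCode (p : ℕ → ℤ) (x : ℝ) : Prop :=
  |x| ≤ 1 ∧ (∀ i, p i ∈ ({-1, 1} : Set ℤ)) ∧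
    ∀ i, tent^[i] x ≠ 0 →
      (0 < tent^[i] x → p i = 1) ∧ (tent^[i] x < 0 → p i = -1)

theorem abs_tent_le_one {x : ℝ} (hx : |x| ≤ 1) : |tent x| ≤ 1 := by
  have h := abs_nonneg x
  rw [tent, abs_le]
  constructor <;> linarith

theorem tent_neg (x : ℝ) : tent (-x) = tent x := by
  simp [tent]

theorem tent_abs (x : ℝ) : tent |x| = tent x := by
  simp [tent]

theorem gray_code_closure_one (p : ℕ → ℤ) (x : ℝ) (hp : IsGrayCode p x) :
    IsGrayCode (fun i => p (i + 1)) (tent x) ∧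
    IsGrayCode (fun i => if i = 0 then -(p 0) else p i) (-x) ∧
    IsGrayCode (fun i => if i = 0 then 1 else p i) |x| := by
  obtain ⟨hx, hdigit, hsign⟩ := hp
  refine ⟨⟨abs_tent_le_one hx, fun i => hdigit (i + 1), fun i => ?_⟩,
    ⟨by rwa [abs_neg], ?_, ?_⟩, ⟨by rwa [abs_abs], ?_, ?_⟩⟩
  · simpa only [Function.iterate_succ_apply] using hsign (i + 1)
  · rintro (_ | i)
    · rcases hdigit 0 with h | h
      · simp [h]
      · rw [Set.mem_singleton_iff] at h
        simp [h]
    · simpa using hdigit (i + 1)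
  · rintro (_ | i)
    · intro h
      have h0 := hsign 0 (by simpa using h)
      simp only [Function.iterate_zero, id_eq] at h0
      simp only [Function.iterate_zero, id_eq, if_true, Left.neg_pos_iff, Left.neg_neg_iff]
      exact ⟨fun hneg => by simp [h0.2 hneg], fun hpos => by simp [h0.1 hpos]⟩
    · simpa [tent_neg] using hsign (i + 1)
  · rintro (_ | i)
    · simp
    · simpa using hdigit (i + 1)
  · rintro (_ | i)
    · simp [(abs_nonneg x).not_gt]
    · simpa [tent_abs] using hsign (i + 1)
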